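/- Let k ≥ 3 be an integer, 0 < δ ≤ 1, and B > 0. There exists a constant c(k, δ) > 0 such that: if M = M(N) is a prime number tending to infinity with the parameter N and f = f_N : Z_M → ℝ satisfies 0 ≤ f(x) ≤ B for all x ∈ Z_M and E(f) ≥ δ for all N, then liminf_{N→∞} E( f(x)·f(x+r)·…·f(x+(k−1)r) | x, r ∈ Z_M ) ≥ c(k, δ). -/

import Mathlib

open Finset Filter
open scoped Classical

noncomputable section

/-- `ε_k := 1/(2^k (k+4)!)`. -/
def epsk (k : ℕ) : ℝ := 1 / (2 ^ k * (Nat.factorial (k + 4)))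

/-- `W(N) := ∏_{p ≤ w(N)} p`. -/
def Wprim (w : ℕ → ℕ) (N : ℕ) : ℕ := ∏ p ∈ (Finset.range (w N + 1)).filter Nat.Prime, p

/-- W-tricked von Mangoldt function. -/
def tildeLambda (W n : ℕ) : ℝ :=
  if Nat.Prime (W * n + 1) then (Nat.totient W : ℝ) / W * Real.log (W * n + 1) else 0

/-- truncated divisor sum `Λ_R`. -/
def LambdaR (R : ℝ) (n : ℕ) : ℝ :=
  ∑ d ∈ n.divisors.filter (fun d : ℕ => (d : ℝ) ≤ R),
    ((ArithmeticFunction.moebius d : ℤ) : ℝ) * Real.log (R / (d : ℝ))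

/-- the representative of `n : ZMod m` lying in `[N, N+m)`. -/
def reprN (N : ℕ) {m : ℕ} (n : ZMod m) : ℕ := N + (n - (N : ZMod m)).val

/-- the condition `ε_k M ≤ n - N ≤ 2 ε_k M` on the representative in `[N, N+m)`. -/
def inWindow (k N : ℕ) {m : ℕ} (n : ZMod m) : Prop :=
  epsk k * m ≤ ((n - (N : ZMod m)).val : ℝ) ∧ ((n - (N : ZMod m)).val : ℝ) ≤ 2 * epsk k * m

/-- `R := M^(1/(k 2^(k+4)))`. -/
def Rpar (k m : ℕ) : ℝ := (m : ℝ) ^ ((1 : ℝ) / (k * 2 ^ (k + 4)))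

/-- the Green–Tao majorant `ν`. -/
def nuGT (k N W : ℕ) {m : ℕ} (n : ZMod m) : ℝ :=
  if inWindow k N n then
    (Nat.totient W : ℝ) / W * (LambdaR (Rpar k m) (W * reprN N n + 1)) ^ 2 / Real.log (Rpar k m)
  else 1

/-- the function `f`. -/
def fGT (k N W : ℕ) {m : ℕ} (n : ZMod m) : ℝ :=
  if inWindow k N n then tildeLambda W (reprN N n) / (k * 2 ^ (k + 5)) else 0

/-- the set of integers `n` with `ε_k M ≤ n - N ≤ 2 ε_k M`. -/
def windowSet (k N m : ℕ) : Finset ℕ :=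
  (Finset.range (N + m + 1)).filter
    (fun n => epsk k * m ≤ (n : ℝ) - N ∧ (n : ℝ) - N ≤ 2 * epsk k * m)

/-- `E(Λ̃(n) | ε_k M ≤ n - N ≤ 2 ε_k M)`. -/
def avgWindow (k N m W : ℕ) : ℝ :=
  (∑ n ∈ windowSet k N m, tildeLambda W n) / (windowSet k N m).card

/-- `E(g(x) | x ∈ Z_m)`. -/
def avgZ (m : ℕ) (g : ZMod m → ℝ) : ℝ := (∑ x ∈ Finset.range m, g (x : ZMod m)) / m

/-- `E(g(x) g(x+r) ⋯ g(x+(k-1)r) | x, r ∈ Z_m)`. -/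
def apAvg (k m : ℕ) (g : ZMod m → ℝ) : ℝ :=
  (∑ x ∈ Finset.range m, ∑ r ∈ Finset.range m,
    ∏ i ∈ Finset.range k, g ((x : ZMod m) + (i : ZMod m) * (r : ZMod m))) / (m : ℝ) ^ 2

/-- a rational number interpreted in `ZMod m`. -/
def ratZMod (q : ℚ) (m : ℕ) : ZMod m := (q.num : ZMod m) * (q.den : ZMod m)⁻¹

/-- the `(m₀,t₀,L₀)`-linear forms condition for a family `ν = ν_N : Z_{M(N)} → ℝ`. -/
def LinearFormsCondition (M : ℕ → ℕ) (ν : ∀ N : ℕ, ZMod (M N) → ℝ) (m₀ t₀ L₀ : ℕ) : Prop :=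
  ∀ m t : ℕ, m ≤ m₀ → t ≤ t₀ →
    ∀ L : Fin m → Fin t → ℚ,
      (∀ i j, (L i j).num.natAbs ≤ L₀ ∧ (L i j).den ≤ L₀) →
      (∀ i, L i ≠ 0) →
      (∀ i i', i ≠ i' → ∀ q : ℚ, L i ≠ q • L i') →
      ∀ δ : ℝ, 0 < δ → ∃ N₀ : ℕ, ∀ N ≥ N₀, L₀ < M N →
        ∀ b : Fin m → ZMod (M N),
          |(∑ x : Fin t → Fin (M N), ∏ i : Fin m,
              ν N (∑ j : Fin t, ratZMod (L i j) (M N) * ((x j : ℕ) : ZMod (M N)) + b i)) /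
              (M N : ℝ) ^ t - 1| ≤ δ

/-- the `m₀`-correlation condition for a family `ν = ν_N : Z_{M(N)} → ℝ`. -/
def CorrelationCondition (M : ℕ → ℕ) (ν : ∀ N : ℕ, ZMod (M N) → ℝ) (m₀ : ℕ) : Prop :=
  ∀ m : ℕ, 1 < m → m ≤ m₀ →
    ∃ τ : ∀ N : ℕ, ZMod (M N) → ℝ,
      (∀ N n, 0 ≤ τ N n) ∧
      (∀ q : ℝ, 1 ≤ q → ∃ C : ℝ, ∀ N, avgZ (M N) (fun n => τ N n ^ q) ≤ C) ∧
      (∀ N : ℕ, ∀ h : Fin m → ZMod (M N),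
        avgZ (M N) (fun x => ∏ i, ν N (x + h i)) ≤
          ∑ i : Fin m, ∑ j : Fin m, if i < j then τ N (h i - h j) else 0)

/-- `k`-pseudorandom measure. -/
def Pseudorandom (k : ℕ) (M : ℕ → ℕ) (ν : ∀ N : ℕ, ZMod (M N) → ℝ) : Prop :=
  (∀ δ : ℝ, 0 < δ → ∃ N₀, ∀ N ≥ N₀, |avgZ (M N) (ν N) - 1| ≤ δ) ∧
  LinearFormsCondition M ν (k * 2 ^ (k - 1)) (3 * k - 4) k ∧
  CorrelationCondition M ν (2 ^ (k - 1))

namespace DensityHJ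

variable {X Y Z T : Type*}

/-- The indicator of a proposition, as a real number. -/
def ind (p : Prop) : ℝ := if p then 1 else 0

lemma ind_of {p : Prop} (h : p) : ind p = 1 := if_pos h

lemma ind_not {p : Prop} (h : ¬p) : ind p = 0 := if_neg h

lemma ind_nonneg (p : Prop) : 0 ≤ ind p := by unfold ind; split_ifs <;> norm_num

lemma ind_le_one (p : Prop) : ind p ≤ 1 := by unfold ind; split_ifs <;> norm_num

/-- The average of a real function over a finite type (`0` on the empty type). -/
def avg (f : X → ℝ) : ℝ := (∑ᶠ x, f x) / Nat.card X

lemma avg_eq [Fintype X] (f : X → ℝ) : avg f = (∑ x, f x) / Fintype.card X := by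
  rw [avg, finsum_eq_sum_of_fintype, Nat.card_eq_fintype_card]

lemma avg_comp_equiv (e : X ≃ Y) (f : Y → ℝ) : avg (fun x => f (e x)) = avg f := by
  rw [avg, avg, finsum_comp_equiv e, Nat.card_congr e]

lemma avg_prod [Finite X] [Finite Y] (f : X × Y → ℝ) :
    avg f = avg fun x => avg fun y => f (x, y) := by
  have := Fintype.ofFinite X
  have := Fintype.ofFinite Y
  simp only [avg_eq, Fintype.sum_prod_type, Fintype.card_prod, ← Finset.sum_div, div_div,
    Nat.cast_mul]
  rw [mul_comm]

lemma avg_comm [Finite X] [Finite Y] (f : X → Y → ℝ) :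
    (avg fun x => avg fun y => f x y) = avg fun y => avg fun x => f x y := by
  rw [← avg_prod fun p : X × Y => f p.1 p.2, ← avg_prod fun p : Y × X => f p.2 p.1,
    ← avg_comp_equiv (Equiv.prodComm X Y)]
  rfl

lemma avg_const [Finite X] [Nonempty X] (c : ℝ) : (avg fun _ : X => c) = c := by
  have := Fintype.ofFinite X
  have h : (Fintype.card X : ℝ) ≠ 0 := by simp
  simp only [avg_eq, Finset.sum_const, Finset.card_univ, nsmul_eq_mul]
  field_simp

lemma avg_add [Finite X] (f g : X → ℝ) : (avg fun x => f x + g x) = avg f + avg g := by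
  have := Fintype.ofFinite X
  simp only [avg_eq, Finset.sum_add_distrib, add_div]

lemma avg_sub [Finite X] (f g : X → ℝ) : (avg fun x => f x - g x) = avg f - avg g := by
  have := Fintype.ofFinite X
  simp only [avg_eq, Finset.sum_sub_distrib, sub_div]

lemma avg_const_mul [Finite X] (c : ℝ) (f : X → ℝ) : (avg fun x => c * f x) = c * avg f := by
  have := Fintype.ofFinite X
  simp only [avg_eq, ← Finset.mul_sum, mul_div_assoc]

lemma avg_sum [Finite X] [Fintype T] (f : T → X → ℝ) :
    (avg fun x => ∑ t, f t x) = ∑ t, avg (f t) := by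
  have := Fintype.ofFinite X
  simp only [avg_eq, ← Finset.sum_div]
  rw [Finset.sum_comm]

lemma avg_mono [Finite X] {f g : X → ℝ} (h : ∀ x, f x ≤ g x) : avg f ≤ avg g := by
  have := Fintype.ofFinite X
  simp only [avg_eq]
  gcongr with x
  exact h x

lemma avg_nonneg [Finite X] {f : X → ℝ} (h : ∀ x, 0 ≤ f x) : 0 ≤ avg f := by
  have := Fintype.ofFinite X
  rw [avg_eq]
  have := Finset.sum_nonneg fun x (_ : x ∈ univ) => h x
  positivity

lemma avg_le [Finite X] {f : X → ℝ} {c : ℝ} (hc : 0 ≤ c) (h : ∀ x, f x ≤ c) : avg f ≤ c := by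
  rcases isEmpty_or_nonempty X with hX | hX
  · simpa [avg] using hc
  · exact (avg_mono h).trans (avg_const c).le

lemma le_avg [Finite X] [Nonempty X] {f : X → ℝ} {c : ℝ} (h : ∀ x, c ≤ f x) : c ≤ avg f :=
  (avg_const c).ge.trans (avg_mono h)

lemma avg_nonpos [Finite X] {f : X → ℝ} (h : ∀ x, f x ≤ 0) : avg f ≤ 0 := avg_le le_rfl h

/-- Averaging over the range of an injection. -/
lemma avg_ind_range_mul [Finite X] [Finite Z] {j : Z → X} (hj : j.Injective) (f : X → ℝ) :
    (avg fun x => ind (x ∈ Set.range j) * f x) =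
      (Nat.card Z : ℝ) / Nat.card X * avg fun z => f (j z) := by
  have := Fintype.ofFinite X
  have := Fintype.ofFinite Z
  have hsum : ∑ x, ind (x ∈ Set.range j) * f x = ∑ z, f (j z) := by
    simp only [ind, ite_mul, one_mul, zero_mul]
    rw [← Finset.sum_filter, ← Finset.sum_image (g := j) (f := f) hj.injOn]
    congr 1
    ext x
    simp
  rcases isEmpty_or_nonempty Z with hZ | hZ
  · rw [avg_eq, hsum]
    simp
  have h : (Fintype.card Z : ℝ) ≠ 0 := by simp
  simp only [avg_eq, hsum, Nat.card_eq_fintype_card]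
  field_simp

/-- If bounded values average to at least `κ` and every `x` whose value is at least `κ / 2` has a
tag, then some tag is shared by a positive proportion of all `x`. -/
lemma exists_popular_tag [Finite X] [Finite T] {f : X → ℝ} (hf : ∀ x, f x ≤ 1) {κ : ℝ} (hκ : 0 < κ)
    (h : κ ≤ avg f) {R : X → T → Prop} (hR : ∀ x, κ / 2 ≤ f x → ∃ t, R x t) :
    ∃ t, κ / 2 / Nat.card T ≤ avg fun x => ind (R x t) := by
  have := Fintype.ofFinite T
  have h1 : ∀ x, f x ≤ κ / 2 + ∑ t, ind (R x t) := by
    intro x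
    have h0 : 0 ≤ ∑ t, ind (R x t) := Finset.sum_nonneg fun t _ => ind_nonneg _
    by_cases hx : κ / 2 ≤ f x
    · obtain ⟨t, ht⟩ := hR x hx
      have h2 : ind (R x t) ≤ ∑ t, ind (R x t) :=
        Finset.single_le_sum (f := fun t => ind (R x t)) (fun t _ => ind_nonneg _)
          (Finset.mem_univ t)
      rw [ind_of ht] at h2
      linarith [hf x]
    · linarith
  have h2 : κ / 2 ≤ ∑ t, avg fun x => ind (R x t) := by
    have h3 := avg_mono h1
    rw [avg_add, avg_sum] at h3
    have h4 : (avg fun _ : X => κ / 2) ≤ κ / 2 := avg_le (by positivity) fun _ => le_rfl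
    linarith
  have hT : Nonempty T := by
    by_contra hT
    rw [not_nonempty_iff] at hT
    simp at h2
    linarith
  by_contra! hlt
  have h3 : ∑ t, (avg fun x => ind (R x t)) < ∑ _t : T, κ / 2 / Nat.card T :=
    Finset.sum_lt_sum_of_nonempty Finset.univ_nonempty fun t _ => hlt t
  have h : (Fintype.card T : ℝ) ≠ 0 := by simp
  rw [Finset.sum_const, Finset.card_univ, nsmul_eq_mul, Nat.card_eq_fintype_card,
    mul_div_cancel₀ _ h] at h3
  linarith

/-- If all values are barely above the average, then no value is far below it. -/
lemma le_of_avg_of_forall_le [Finite X] {s : X → ℝ} {δ ε : ℝ} (hs : ∀ x, s x ≤ δ + ε)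
    (h : δ - ε ≤ avg s) (hε : 0 ≤ ε) (x : X) : δ - 2 * Nat.card X * ε ≤ s x := by
  have := Fintype.ofFinite X
  have hX : Nonempty X := ⟨x⟩
  have hc : (0 : ℝ) < Fintype.card X := by exact_mod_cast Fintype.card_pos
  rw [avg_eq, le_div_iff₀ hc] at h
  have h1 : ∑ y ∈ univ.erase x, s y ≤ (Fintype.card X - 1) * (δ + ε) := by
    refine (Finset.sum_le_card_nsmul _ _ _ fun y _ => hs y).trans (le_of_eq ?_)
    rw [Finset.card_erase_of_mem (Finset.mem_univ x), Finset.card_univ, nsmul_eq_mul,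
      Nat.cast_sub Fintype.card_pos, Nat.cast_one]
  rw [← Finset.add_sum_erase _ _ (Finset.mem_univ x)] at h
  rw [Nat.card_eq_fintype_card]
  nlinarith

variable {α β Λ : Type} {ι κ ζ η : Type}

/-- Substitution of `x` for the variables of the word `V`, whose entries are letters from `α` or
variables from `η`. -/
def app (V : ι → α ⊕ η) (x : η → α) : ι → α := fun i => (V i).elim id x

/-- Every variable occurs in the word `V`. The image of `app V` is then a combinatorial subspace. -/
def Proper (V : ι → α ⊕ η) : Prop := ∀ e, ∃ i, V i = Sum.inr e

/-- Substitution of the word `W` for the variables of the word `V`. -/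
def subst (V : ι → α ⊕ η) (W : η → α ⊕ ζ) : ι → α ⊕ ζ := fun i => (V i).elim Sum.inl W

/-- Translation of the letters of a variable word. -/
def mapLetters (f : α → β) (V : ι → α ⊕ η) : ι → β ⊕ η := fun i => (V i).map f id

/-- The set `A` contains a combinatorial line. -/
def HasLine (A : Set (ι → α)) : Prop :=
  ∃ V : ι → α ⊕ Unit, Proper V ∧ ∀ t, app V (fun _ => t) ∈ A

/-- Gluing words along a splitting of the coordinates. -/
def glue (e : ι ≃ κ ⊕ ζ) {L : Type} (x : κ → L) (y : ζ → L) : ι → L := Sum.elim x y ∘ e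

lemma app_subst (V : ι → α ⊕ η) (W : η → α ⊕ ζ) (x : ζ → α) :
    app (subst V W) x = app V (app W x) := by
  funext i
  unfold app subst
  rcases V i with a | a <;> rfl

lemma Proper.subst {V : ι → α ⊕ η} {W : η → α ⊕ ζ} (hV : Proper V) (hW : Proper W) :
    Proper (subst V W) := by
  intro e
  obtain ⟨i, hi⟩ := hW e
  obtain ⟨j, hj⟩ := hV i
  exact ⟨j, by simp [DensityHJ.subst, hj, hi]⟩

lemma Proper.mapLetters {V : ι → α ⊕ η} (hV : Proper V) (f : α → β) :
    Proper (mapLetters f V) := by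
  intro e
  obtain ⟨i, hi⟩ := hV e
  exact ⟨i, by simp [DensityHJ.mapLetters, hi]⟩

lemma app_mapLetters (f : α → β) (V : ι → α ⊕ η) (x : η → α) :
    app (mapLetters f V) (f ∘ x) = f ∘ app V x := by
  funext i
  simp only [app, mapLetters, Function.comp_apply]
  rcases V i with a | a <;> rfl

lemma mapLetters_mapLetters {γ : Type} (f : β → γ) (g : α → β) (V : ι → α ⊕ η) :
    mapLetters f (mapLetters g V) = mapLetters (f ∘ g) V := by
  funext i
  simp only [mapLetters]
  rcases V i with a | a <;> rfl

lemma mapLetters_id (V : ι → α ⊕ η) : mapLetters id V = V := by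
  funext i
  simp only [mapLetters]
  rcases V i with a | a <;> rfl

lemma Proper.app_injective {V : ι → α ⊕ η} (hV : Proper V) : Function.Injective (app V) := by
  intro x y h
  funext v
  obtain ⟨i, hi⟩ := hV v
  simpa [app, hi] using congrFun h i

lemma HasLine.of_app {V : ι → α ⊕ η} (hV : Proper V) {A : Set (ι → α)}
    (h : HasLine {x | app V x ∈ A}) : HasLine A := by
  obtain ⟨W, hW, hl⟩ := h
  exact ⟨subst V W, hV.subst hW, fun t => by rw [app_subst]; exact hl t⟩

section Glue

variable (e : ι ≃ κ ⊕ ζ)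

lemma app_glue (V : κ → α ⊕ η) (W : ζ → α ⊕ η) (x : η → α) :
    app (glue e V W) x = glue e (app V x) (app W x) := by
  funext i
  simp only [app, glue, Function.comp_apply]
  rcases e i with a | a <;> rfl

lemma comp_glue {L L' : Type} (f : L → L') (x : κ → L) (y : ζ → L) :
    f ∘ glue e x y = glue e (f ∘ x) (f ∘ y) := by
  simp only [glue, ← Function.comp_assoc, Sum.comp_elim]

@[simp] lemma app_inr (x : η → α) : app (Sum.inr : η → α ⊕ η) x = x := rfl

@[simp] lemma app_inl_comp (y : ι → α) (x : η → α) :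
    app (Sum.inl ∘ y : ι → α ⊕ η) x = y := rfl

lemma Proper.glue_left {V : κ → α ⊕ η} (hV : Proper V) (W : ζ → α ⊕ η) :
    Proper (glue e V W) := by
  intro v
  obtain ⟨i, hi⟩ := hV v
  exact ⟨e.symm (Sum.inl i), by simp [glue, hi]⟩

lemma Proper.glue_right (V : κ → α ⊕ η) {W : ζ → α ⊕ η} (hW : Proper W) :
    Proper (glue e V W) := by
  intro v
  obtain ⟨i, hi⟩ := hW v
  exact ⟨e.symm (Sum.inr i), by simp [glue, hi]⟩

lemma proper_inr : Proper (Sum.inr : η → α ⊕ η) := fun e => ⟨e, rfl⟩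

/-- An average over words is an iterated average over the two parts of the words. -/
lemma avg_glue [Finite ι] [Finite κ] [Finite ζ] [Finite Λ] (F : (ι → Λ) → ℝ) :
    avg F = avg fun x : κ → Λ => avg fun y : ζ → Λ => F (glue e x y) := by
  rw [← avg_prod fun p : (κ → Λ) × (ζ → Λ) => F (glue e p.1 p.2),
    ← avg_comp_equiv ((e.arrowCongr (Equiv.refl Λ)).trans (Equiv.sumArrowEquivProdArrow κ ζ Λ))]
  congr 1
  funext x
  congr 1
  funext i
  simp only [glue, Function.comp_apply]
  rcases h : e i with a | a <;> simp [Equiv.sumArrowEquivProdArrow, Equiv.arrowCongr, ← h]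

end Glue

/-- A large index set splits off a part with exactly `m` elements. -/
lemma exists_split [Finite ι] {m n : ℕ} (h : m + n ≤ Nat.card ι) :
    ∃ (r : ℕ) (_ : ι ≃ Fin m ⊕ Fin r), n ≤ r := by
  refine ⟨Nat.card ι - m, (Finite.equivFin ι).trans ((finCongr ?_).trans finSumFinEquiv.symm), ?_⟩
    <;> omega

/-- The function has nonpositive average on every subspace of dimension at least `d`, when the
letters are weighted by the sizes of the fibres of `π`. -/
def Neg (π : Λ → α) (d : ℕ) (g : (ι → α) → ℝ) : Prop :=
  ∀ (η : Type) [Finite η], d ≤ Nat.card η → ∀ V : ι → α ⊕ η, Proper V →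
    avg (fun c : η → Λ => g (app V (π ∘ c))) ≤ 0

lemma Neg.app {π : Λ → α} {d : ℕ} {g : (ι → α) → ℝ} (h : Neg π d g) {V : ι → α ⊕ η}
    (hV : Proper V) : Neg π d fun x => g (app V x) := by
  intro ξ _ hξ W hW
  simpa only [app_subst] using h ξ hξ (DensityHJ.subst V W) (hV.subst hW)

/-- A function with nonpositive uniform averages over subspaces has almost nonpositive weighted
averages in high dimension. -/
lemma weighted_avg_le [Finite α] [Nonempty α] [Finite Λ] {π : Λ → α}
    (hπ : π.Surjective) (d : ℕ) {κ : ℝ} (hκ : 0 < κ) :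
    ∃ m, ∀ (ι : Type) [Finite ι], m ≤ Nat.card ι → ∀ g : (ι → α) → ℝ, (∀ x, g x ≤ 1) →
      Neg (id : α → α) d g → avg (fun c : ι → Λ => g (π ∘ c)) ≤ κ := by
  have : Nonempty Λ := hπ.nonempty
  set τ : ℝ := (Nat.card (Fin d → α) : ℝ) / Nat.card (Fin d → Λ) with hτ
  have hinj : Function.Injective fun x : Fin d → α => Function.surjInv hπ ∘ x :=
    (Function.injective_surjInv hπ).comp_left
  have hτ0 : 0 < τ := div_pos (by exact_mod_cast Nat.card_pos) (by exact_mod_cast Nat.card_pos)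
  have hτ1 : τ ≤ 1 := div_le_one_of_le₀
    (by exact_mod_cast Nat.card_le_card_of_injective _ hinj) (by positivity)
  have key : ∀ j : ℕ, ∃ m, ∀ (ι : Type) [Finite ι], m ≤ Nat.card ι → ∀ g : (ι → α) → ℝ,
      (∀ x, g x ≤ 1) → Neg (id : α → α) d g →
      avg (fun c : ι → Λ => g (π ∘ c)) ≤ (1 - τ) ^ j := by
    intro j
    induction j with
    | zero => exact ⟨0, fun ι _ _ g hg _ => by simpa using avg_le zero_le_one fun c => hg _⟩
    | succ j ih =>
      obtain ⟨m, hm⟩ := ih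
      refine ⟨d + m, fun ι _ hι g hg hneg => ?_⟩
      obtain ⟨r, e, hr⟩ := exists_split hι
      set φ : (Fin d → Λ) → ℝ := fun c => avg fun c' : Fin r → Λ => g (glue e (π ∘ c) (π ∘ c'))
      have hφ : ∀ c, φ c ≤ (1 - τ) ^ j := fun c => by
        have hV : Proper (glue e (Sum.inl ∘ π ∘ c : Fin d → α ⊕ Fin r) Sum.inr) :=
          Proper.glue_right e _ proper_inr
        have := hm (Fin r) (by simpa using hr) _ (fun _ => hg _) (hneg.app hV)
        simpa only [app_glue, app_inl_comp, app_inr] using this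
      have hrange : (avg fun x : Fin d → α => φ (Function.surjInv hπ ∘ x)) ≤ 0 := by
        rw [avg_comm]
        refine avg_nonpos fun c' => ?_
        have hV : Proper (glue e Sum.inr (Sum.inl ∘ π ∘ c' : Fin r → α ⊕ Fin d)) :=
          Proper.glue_left e proper_inr _
        have := hneg (Fin d) (by simp) _ hV
        simp only [app_glue, app_inl_comp, app_inr, Function.id_comp] at this
        simp only [← Function.comp_assoc, (Function.rightInverse_surjInv hπ).comp_eq_id,
          Function.id_comp]
        exact this
      have hmul := avg_ind_range_mul hinj φ
      have hsplit : avg φ ≤ avg fun c =>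
          ind (c ∈ Set.range fun x : Fin d → α => Function.surjInv hπ ∘ x) * φ c +
          ((1 - τ) ^ j - (1 - τ) ^ j *
            (ind (c ∈ Set.range fun x : Fin d → α => Function.surjInv hπ ∘ x) * 1)) := by
        refine avg_mono fun c => ?_
        by_cases hc : c ∈ Set.range fun x : Fin d → α => Function.surjInv hπ ∘ x
        · rw [ind_of hc]
          linarith
        · rw [ind_not hc]
          linarith [hφ c]
      rw [avg_add, hmul, avg_sub, avg_const, avg_const_mul, avg_ind_range_mul hinj, avg_const,
        ← hτ] at hsplit
      rw [avg_glue e]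
      simp only [comp_glue]
      refine hsplit.trans ?_
      have := mul_nonpos_of_nonneg_of_nonpos hτ0.le hrange
      rw [pow_succ]
      linarith
  obtain ⟨j, hj⟩ := exists_pow_lt_of_lt_one hκ (sub_lt_self (1 : ℝ) hτ0)
  obtain ⟨m, hm⟩ := key j
  exact ⟨m, fun ι _ hι g hg hneg => (hm ι hι g hg hneg).trans hj.le⟩

/-- The density Hales–Jewett property for sets of density at least `δ`. -/
def Good (α : Type) (δ : ℝ) : Prop :=
  ∃ n, ∀ (ι : Type) [Finite ι], n ≤ Nat.card ι → ∀ A : Set (ι → α),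
    δ ≤ avg (fun x => ind (x ∈ A)) → HasLine A

/-- The density Hales–Jewett theorem over the alphabet `α`. -/
def DHJ (α : Type) : Prop := ∀ δ, 0 < δ → Good α δ

lemma Good.mono {δ δ' : ℝ} (h : Good α δ) (hδ : δ ≤ δ') : Good α δ' := by
  obtain ⟨n, hn⟩ := h
  exact ⟨n, fun ι _ hι A hA => hn ι hι A (hδ.trans hA)⟩

/-- A line-free set has density less than `δ` on all large subspaces. -/
lemma neg_of_not_hasLine [Finite α] [Nonempty α] {δ : ℝ} {n : ℕ}
    (hn : ∀ (ι : Type) [Finite ι], n ≤ Nat.card ι → ∀ A : Set (ι → α),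
      δ ≤ avg (fun x => ind (x ∈ A)) → HasLine A)
    {A : Set (ι → α)} (hA : ¬HasLine A) : Neg (id : α → α) n fun x => ind (x ∈ A) - δ := by
  intro η _ hη V hV
  rw [avg_sub, avg_const]
  by_contra! h
  exact hA ((hn η hη {x | app V x ∈ A} (by simpa using! (sub_pos.1 h).le)).of_app hV)

/-- Replacement of the extra letter `none` by `b`. -/
def fill (b : β) (o : Option β) : β := o.getD b

lemma fill_surjective (b : β) : Function.Surjective (fill b) := fun a => ⟨some a, rfl⟩

lemma fill_comp_some (b : β) : fill b ∘ some = id := rfl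

section Weighted

variable [Finite β] [Nonempty β] [Finite Λ]

/-- The density Hales–Jewett theorem for letters weighted by the fibres of `π`. -/
lemma DHJ.exists_line_weighted (h : DHJ β) {π : Λ → β} (hπ : π.Surjective) {δ : ℝ} (hδ : 0 < δ) :
    ∃ m, ∀ (ι : Type) [Finite ι], m ≤ Nat.card ι → ∀ A : Set (ι → β),
      δ ≤ avg (fun c : ι → Λ => ind (π ∘ c ∈ A)) → HasLine A := by
  have : Nonempty Λ := hπ.nonempty
  obtain ⟨n, hn⟩ := h (δ / 2) (by positivity)
  obtain ⟨m, hm⟩ := weighted_avg_le hπ n (κ := δ / 4) (by positivity)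
  refine ⟨m, fun ι _ hι A hA => ?_⟩
  by_contra hline
  have := hm ι hι (fun x => ind (x ∈ A) - δ / 2) (fun x => by linarith [ind_le_one (x ∈ A)])
    (neg_of_not_hasLine hn hline)
  rw [avg_sub, avg_const] at this
  linarith

/-- The weighted multidimensional density Hales–Jewett theorem: dense sets contain combinatorial
subspaces of any fixed dimension. -/
lemma DHJ.exists_subspace_weighted (h : DHJ β) {π : Λ → β} (hπ : π.Surjective) (d : ℕ) {δ : ℝ}
    (hδ : 0 < δ) :
    ∃ m, ∀ (ι : Type) [Finite ι], m ≤ Nat.card ι → ∀ A : Set (ι → β),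
      δ ≤ avg (fun c : ι → Λ => ind (π ∘ c ∈ A)) →
      ∃ V : ι → β ⊕ Fin d, Proper V ∧ ∀ z, app V z ∈ A := by
  induction d generalizing δ with
  | zero =>
    refine ⟨0, fun ι _ _ A hA => ?_⟩
    have : ∃ c : ι → Λ, π ∘ c ∈ A := by
      by_contra! hc
      linarith [avg_nonpos fun c : ι → Λ => (ind_not (hc c)).le]
    obtain ⟨c, hc⟩ := this
    exact ⟨Sum.inl ∘ π ∘ c, fun v => v.elim0, fun z => by rwa [app_inl_comp]⟩
  | succ d ih =>
    obtain ⟨m₁, hm₁⟩ := h.exists_line_weighted hπ (half_pos hδ)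
    have hT : (0 : ℝ) < Nat.card (Fin m₁ → β ⊕ Unit) := by exact_mod_cast Nat.card_pos
    obtain ⟨m₂, hm₂⟩ := ih (δ := δ / 2 / Nat.card (Fin m₁ → β ⊕ Unit)) (by positivity)
    refine ⟨m₁ + m₂, fun ι _ hι A hA => ?_⟩
    obtain ⟨r, e, hr⟩ := exists_split hι
    rw [avg_glue e, avg_comm] at hA
    simp only [comp_glue] at hA
    obtain ⟨V, hV⟩ := exists_popular_tag (fun c => avg_le zero_le_one fun _ => ind_le_one _) hδ hA
      (R := fun c' V => Proper V ∧ ∀ t, glue e (app V fun _ => t) (π ∘ c') ∈ A)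
      fun c' hc' => hm₁ (Fin m₁) (by simp) {x | glue e x (π ∘ c') ∈ A} hc'
    obtain ⟨W, hW, hWA⟩ := hm₂ (Fin r) (by simpa using hr)
      {y | Proper V ∧ ∀ t, glue e (app V fun _ => t) y ∈ A} hV
    have hVp : Proper V := (hWA fun _ => Classical.arbitrary β).1
    refine ⟨glue e (subst V fun _ => Sum.inr 0) (subst W fun v => Sum.inr v.succ), ?_, fun z => ?_⟩
    · intro v
      induction v using Fin.cases with
      | zero =>
        obtain ⟨i, hi⟩ := hVp ()
        exact ⟨e.symm (Sum.inl i), by simp [glue, subst, hi]⟩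
      | succ v =>
        obtain ⟨i, hi⟩ := hW v
        exact ⟨e.symm (Sum.inr i), by simp [glue, subst, hi]⟩
    · rw [app_glue, app_subst, app_subst]
      exact (hWA _).2 (z 0)

/-- A function with nonpositive averages over large subspaces has an almost nonpositive integral
over every set that does not distinguish the letters `none` and `some b`. -/
lemma DHJ.avg_mul_ind_fill_le (h : DHJ β) {π : Λ → Option β} (hπ : π.Surjective) (b : β) (d : ℕ)
    {κ : ℝ} (hκ : 0 < κ) :
    ∃ m, ∀ (ι : Type) [Finite ι], m ≤ Nat.card ι → ∀ g : (ι → Option β) → ℝ, (∀ x, g x ≤ 1) →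
      Neg π d g → ∀ D : Set (ι → β),
        avg (fun c : ι → Λ => g (π ∘ c) * ind (fill b ∘ π ∘ c ∈ D)) ≤ κ := by
  have : Nonempty Λ := hπ.nonempty
  obtain ⟨ε, hε, rfl⟩ : ∃ ε, 0 < ε ∧ κ = ε + ε := ⟨κ / 2, half_pos hκ, (add_halves κ).symm⟩
  have hmul : ∀ {x : ℝ} (p : Prop), x ≤ 1 → x * ind p ≤ ind p := fun p hx =>
    mul_le_of_le_one_left (ind_nonneg p) hx
  obtain ⟨m₁, hm₁⟩ := h.exists_subspace_weighted ((fill_surjective b).comp hπ) d (half_pos hε)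
  set r₀ : ℝ := (Nat.card (Fin d → Λ) : ℝ) / Nat.card (Fin m₁ → Λ)
  have hr₀ : 0 < r₀ :=
    div_pos (by exact_mod_cast Nat.card_pos) (by exact_mod_cast Nat.card_pos)
  have hT : (0 : ℝ) < Nat.card (Fin m₁ → β ⊕ Fin d) := by exact_mod_cast Nat.card_pos
  set τ : ℝ := min (r₀ * (ε / 2 / Nat.card (Fin m₁ → β ⊕ Fin d))) 1
  have hτ0 : 0 < τ := lt_min (by positivity) one_pos
  have hτ1 : 0 ≤ 1 - τ := sub_nonneg.2 (min_le_right _ _)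
  have key : ∀ j : ℕ, ∃ m, ∀ (ι : Type) [Finite ι], m ≤ Nat.card ι → ∀ g : (ι → Option β) → ℝ,
      (∀ x, g x ≤ 1) → Neg π d g → ∀ D : Set (ι → β),
      avg (fun c : ι → Λ => g (π ∘ c) * ind (fill b ∘ π ∘ c ∈ D)) ≤
        ε + (1 - τ) ^ j * avg (fun c : ι → Λ => ind (fill b ∘ π ∘ c ∈ D)) := by
    intro j
    induction j with
    | zero =>
      refine ⟨0, fun ι _ _ g hg _ D => ?_⟩
      have := avg_mono fun c : ι → Λ => hmul (fill b ∘ π ∘ c ∈ D) (hg (π ∘ c))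
      linarith
    | succ j ih =>
      obtain ⟨m, hm⟩ := ih
      refine ⟨m₁ + m, fun ι _ hι g hg hneg D => ?_⟩
      obtain ⟨r, e, hr⟩ := exists_split hι
      set P : ℝ := avg (fun c : ι → Λ => ind (fill b ∘ π ∘ c ∈ D)) with hP
      have hP0 : 0 ≤ P := avg_nonneg fun _ => ind_nonneg _
      have hP1 : P ≤ 1 := avg_le zero_le_one fun _ => ind_le_one _
      rcases lt_or_ge P ε with hlt | hge
      · have h1 := avg_mono fun c : ι → Λ => hmul (fill b ∘ π ∘ c ∈ D) (hg (π ∘ c))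
        have h2 : 0 ≤ (1 - τ) ^ (j + 1) * P := by positivity
        linarith
      rw [hP, avg_glue e, avg_comm] at hge
      simp only [comp_glue] at hge
      obtain ⟨V, hV⟩ := exists_popular_tag
        (fun c => avg_le zero_le_one fun _ => ind_le_one _) hε hge
        (R := fun c' V => Proper V ∧ ∀ z, glue e (app V z) (fill b ∘ π ∘ c') ∈ D)
        fun c' hc' => hm₁ (Fin m₁) (by simp) {x | glue e x (fill b ∘ π ∘ c') ∈ D} hc'
      have hVp : Proper V := by
        by_contra hVp
        have := avg_nonpos fun c' : Fin r → Λ => (ind_not (p := Proper V ∧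
          ∀ z, glue e (app V z) (fill b ∘ π ∘ c') ∈ D) fun hc => hVp hc.1).le
        have : 0 < ε / 2 / Nat.card (Fin m₁ → β ⊕ Fin d) := by positivity
        linarith
      simp only [hVp, true_and] at hV
      set Y : Set (Fin r → β) := {y | ∀ z, glue e (app V z) y ∈ D}
      set VΛ : Fin m₁ → Λ ⊕ Fin d := mapLetters (Function.surjInv hπ ∘ some) V
      have hVΛ : ∀ c, π ∘ app VΛ c = app (mapLetters some V) (π ∘ c) := fun c => by
        rw [← app_mapLetters, mapLetters_mapLetters, ← Function.comp_assoc,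
          (Function.rightInverse_surjInv hπ).comp_eq_id, Function.id_comp]
      have hfill : ∀ c, fill b ∘ π ∘ app VΛ c = app V (fill b ∘ π ∘ c) := fun c => by
        rw [hVΛ, ← app_mapLetters, mapLetters_mapLetters, fill_comp_some, mapLetters_id]
      have hinj : Function.Injective (app VΛ) := (hVp.mapLetters _).app_injective
      set D' : (Fin m₁ → Λ) → Set (Fin r → β) := fun c =>
        {y | glue e (fill b ∘ π ∘ c) y ∈ D ∧ ¬(c ∈ Set.range (app VΛ) ∧ y ∈ Y)}
      have hind : ∀ (c : Fin m₁ → Λ) y, ind (glue e (fill b ∘ π ∘ c) y ∈ D) =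
          ind (y ∈ D' c) + ind (c ∈ Set.range (app VΛ)) * ind (y ∈ Y) := by
        intro c y
        by_cases hc : c ∈ Set.range (app VΛ) ∧ y ∈ Y
        · have h1 : glue e (fill b ∘ π ∘ c) y ∈ D := by
            obtain ⟨⟨c, rfl⟩, hy⟩ := hc
            rw [hfill]
            exact hy _
          have h2 : y ∉ D' c := fun hy => hy.2 hc
          rw [ind_of h1, ind_not h2, ind_of hc.1, ind_of hc.2]
          norm_num
        · have h2 : ind (c ∈ Set.range (app VΛ)) * ind (y ∈ Y) = 0 := by
            rw [not_and_or] at hc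
            rcases hc with hc | hc
            · rw [ind_not hc, zero_mul]
            · rw [ind_not hc, mul_zero]
          have h3 : y ∈ D' c ↔ glue e (fill b ∘ π ∘ c) y ∈ D := and_iff_left hc
          rw [h2, h3, add_zero]
      have hPsum : P = (avg fun c => avg fun c' : Fin r → Λ => ind (fill b ∘ π ∘ c' ∈ D' c)) +
          r₀ * avg fun c' : Fin r → Λ => ind (fill b ∘ π ∘ c' ∈ Y) := by
        rw [hP, avg_glue e]
        simp only [comp_glue, hind, avg_add, avg_const_mul]
        rw [avg_ind_range_mul hinj, avg_const]
      have hD' : ∀ c, (avg fun c' : Fin r → Λ =>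
          g (glue e (π ∘ c) (π ∘ c')) * ind (fill b ∘ π ∘ c' ∈ D' c)) ≤ ε +
            (1 - τ) ^ j * avg (fun c' : Fin r → Λ => ind (fill b ∘ π ∘ c' ∈ D' c)) := fun c => by
        have hW : Proper (glue e (Sum.inl ∘ π ∘ c : Fin m₁ → Option β ⊕ Fin r) Sum.inr) :=
          Proper.glue_right e _ proper_inr
        have := hm (Fin r) (by simpa using hr) _ (fun _ => hg _) (hneg.app hW) (D' c)
        simpa only [app_glue, app_inl_comp, app_inr] using this
      have hY : (avg fun c => avg fun c' : Fin r → Λ =>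
          g (glue e (π ∘ app VΛ c) (π ∘ c')) * ind (fill b ∘ π ∘ c' ∈ Y)) ≤ 0 := by
        rw [avg_comm]
        refine avg_nonpos fun c' => ?_
        simp only [mul_comm _ (ind (fill b ∘ π ∘ c' ∈ Y)), avg_const_mul]
        refine mul_nonpos_of_nonneg_of_nonpos (ind_nonneg _) ?_
        have hW : Proper (glue e (mapLetters some V)
            (Sum.inl ∘ π ∘ c' : Fin r → Option β ⊕ Fin d)) :=
          Proper.glue_left e (hVp.mapLetters _) _
        simpa only [app_glue, app_inl_comp, hVΛ] using hneg (Fin d) (by simp) _ hW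
      have hsplit : avg (fun c : ι → Λ => g (π ∘ c) * ind (fill b ∘ π ∘ c ∈ D)) =
          (avg fun c => avg fun c' : Fin r → Λ =>
            g (glue e (π ∘ c) (π ∘ c')) * ind (fill b ∘ π ∘ c' ∈ D' c)) +
          r₀ * avg fun c => avg fun c' : Fin r → Λ =>
            g (glue e (π ∘ app VΛ c) (π ∘ c')) * ind (fill b ∘ π ∘ c' ∈ Y) := by
        rw [avg_glue e, ← avg_ind_range_mul hinj fun c => avg fun c' : Fin r → Λ =>
            g (glue e (π ∘ c) (π ∘ c')) * ind (fill b ∘ π ∘ c' ∈ Y), ← avg_add]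
        simp only [comp_glue, hind, ← avg_const_mul, ← avg_add]
        congr! 4
        ring
      have h1 := avg_mono hD'
      rw [avg_add, avg_const, avg_const_mul] at h1
      have h2 := mul_nonpos_of_nonneg_of_nonpos hr₀.le hY
      have h3 : τ ≤ r₀ * avg fun c' : Fin r → Λ => ind (fill b ∘ π ∘ c' ∈ Y) :=
        (min_le_left _ _).trans (mul_le_mul_of_nonneg_left hV hr₀.le)
      have h4 : (avg fun c => avg fun c' : Fin r → Λ => ind (fill b ∘ π ∘ c' ∈ D' c)) ≤
          (1 - τ) * P := by nlinarith
      have h5 := mul_le_mul_of_nonneg_left h4 (pow_nonneg hτ1 j)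
      rw [hsplit, pow_succ]
      linarith
  obtain ⟨j, hj⟩ := exists_pow_lt_of_lt_one hε (sub_lt_self (1 : ℝ) hτ0)
  obtain ⟨m, hm⟩ := key j
  refine ⟨m, fun ι _ hι g hg hneg D => (hm ι hι g hg hneg D).trans ?_⟩
  have := mul_le_of_le_one_right (pow_nonneg hτ1 j)
    (avg_le zero_le_one fun c : ι → Λ => ind_le_one (fill b ∘ π ∘ c ∈ D))
  linarith

end Weighted

lemma Neg.mono {π : Λ → α} {d d' : ℕ} {g : (ι → α) → ℝ} (h : Neg π d g) (hd : d ≤ d') :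
    Neg π d' g := fun η _ hη V hV => h η (hd.trans hη) V hV

lemma fill_comp_app (b : β) (V : ι → Option β ⊕ η) (x : η → Option β) :
    fill b ∘ app V x = app (mapLetters (fill b) V) (fill b ∘ x) := (app_mapLetters _ _ _).symm

lemma DHJ.avg_mul_compl_le_of_neg [Finite β] [Nonempty β] [Finite Λ] (h : DHJ β)
    {π : Λ → Option β} (hπ : π.Surjective) (d : ℕ) (S : Finset β) {κ : ℝ} (hκ : 0 < κ) :
    ∃ m, ∀ (ι : Type) [Finite ι], m ≤ Nat.card ι → ∀ g : (ι → Option β) → ℝ, (∀ x, g x ≤ 1) →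
      Neg π d g → ∀ D : β → Set (ι → β),
        avg (fun c : ι → Λ => g (π ∘ c) * (1 - ind (∀ b ∈ S, fill b ∘ π ∘ c ∈ D b))) ≤ κ := by
  have : Nonempty Λ := hπ.nonempty
  induction S using Finset.induction_on generalizing κ with
  | empty => exact ⟨0, fun ι _ _ g _ _ D => avg_le hκ.le fun c => by simpa [ind] using hκ.le⟩
  | insert a S _ ih =>
    obtain ⟨m₁, hm₁⟩ := ih (κ := κ / 3) (by positivity)
    obtain ⟨m, hm⟩ := h.avg_mul_ind_fill_le hπ a (max d m₁) (κ := κ / 3) (by positivity)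
    refine ⟨m, fun ι _ hι g hg hneg D => ?_⟩
    set g' : (ι → Option β) → ℝ := fun x =>
      g x * (1 - ind (∀ b ∈ S, fill b ∘ x ∈ D b)) - κ / 3
    have hg' : ∀ x, g' x ≤ 1 := fun x => by
      by_cases hx : ∀ b ∈ S, fill b ∘ x ∈ D b
      · simp only [g', ind_of hx]
        linarith
      · simp only [g', ind_not hx]
        linarith [hg x]
    have hneg' : Neg π m₁ g' := fun η _ hη V hV => by
      have := hm₁ η hη _ (fun _ => hg _) (hneg.app hV)
        fun b => {z | app (mapLetters (fill b) V) z ∈ D b}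
      simp only [g', avg_sub, avg_const, fill_comp_app]
      simpa using this
    have h1 := hm ι hι g hg (hneg.mono (le_max_left _ _)) (D a)ᶜ
    have h2 := hm ι hι g' hg' (hneg'.mono (le_max_right _ _)) (D a)
    have h3 : avg (fun c : ι → Λ =>
        g (π ∘ c) * (1 - ind (∀ b ∈ insert a S, fill b ∘ π ∘ c ∈ D b))) ≤
        avg fun c : ι → Λ => g (π ∘ c) * ind (fill a ∘ π ∘ c ∈ (D a)ᶜ) +
          g' (π ∘ c) * ind (fill a ∘ π ∘ c ∈ D a) + κ / 3 := by
      refine avg_mono fun c => ?_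
      rw [Finset.forall_mem_insert, Set.mem_compl_iff]
      by_cases ha : fill a ∘ π ∘ c ∈ D a
      · simp only [ha, true_and, not_true, ind_of, ind_not, not_false_eq_true, g']
        linarith
      · simp only [ha, false_and, not_false_eq_true, ind_of, ind_not]
        linarith
    rw [avg_add, avg_add, avg_const] at h3
    linarith

/-- A function with nonpositive uniform averages over large subspaces has an almost nonpositive
weighted integral over the complement of an intersection of sets, the `b`-th of which does not
distinguish the letters `none` and `some b`. -/
lemma DHJ.avg_mul_compl_le [Finite β] [Nonempty β] [Finite Λ] (h : DHJ β)
    {π : Λ → Option β} (hπ : π.Surjective) (d : ℕ) {κ : ℝ} (hκ : 0 < κ) :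
    ∃ m, ∀ (ι : Type) [Finite ι], m ≤ Nat.card ι → ∀ g : (ι → Option β) → ℝ, (∀ x, g x ≤ 1) →
      Neg (id : Option β → Option β) d g → ∀ D : β → Set (ι → β),
        avg (fun c : ι → Λ => g (π ∘ c) * (1 - ind (∀ b, fill b ∘ π ∘ c ∈ D b))) ≤ κ := by
  have := Fintype.ofFinite β
  have : Nonempty Λ := hπ.nonempty
  obtain ⟨m₁, hm₁⟩ := weighted_avg_le hπ d (half_pos hκ)
  obtain ⟨m, hm⟩ := h.avg_mul_compl_le_of_neg hπ m₁ Finset.univ (half_pos hκ)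
  refine ⟨m, fun ι _ hι g hg hneg D => ?_⟩
  have h1 := hm ι hι (fun x => g x - κ / 2) (fun x => by linarith [hg x]) (fun η _ hη V hV => by
    rw [avg_sub, avg_const]
    linarith [hm₁ η hη _ (fun _ => hg _) (hneg.app hV)]) D
  have h2 : avg (fun c : ι → Λ => g (π ∘ c) * (1 - ind (∀ b, fill b ∘ π ∘ c ∈ D b))) ≤
      avg fun c : ι → Λ => (g (π ∘ c) - κ / 2) *
        (1 - ind (∀ b ∈ Finset.univ, fill b ∘ π ∘ c ∈ D b)) + κ / 2 := by
    refine avg_mono fun c => ?_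
    simp only [Finset.mem_univ, true_implies]
    nlinarith [ind_nonneg (∀ b, fill b ∘ π ∘ c ∈ D b)]
  rw [avg_add, avg_const] at h2
  linarith

/-- The word over `Option β` that traces the line `V`, the variable being replaced by `none`;
the additional coordinates in `β` make every letter occur. -/
def lineWord {n : ℕ} (V : Fin n → β ⊕ Unit) : Fin n ⊕ β → Option β :=
  Sum.elim (fun i => (V i).elim some fun _ => none) some

lemma lineWord_surjective {n : ℕ} {V : Fin n → β ⊕ Unit} (hV : Proper V) :
    Function.Surjective (lineWord V) := by
  rintro (_ | b)
  · obtain ⟨i, hi⟩ := hV ()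
    exact ⟨Sum.inl i, by simp [lineWord, hi]⟩
  · exact ⟨Sum.inr b, rfl⟩

lemma fill_comp_lineWord {n : ℕ} (V : Fin n → β ⊕ Unit) (b : β) :
    fill b ∘ lineWord V = Sum.elim (app V fun _ => b) id := by
  funext i
  rcases i with i | i
  · simp only [Function.comp_apply, lineWord, Sum.elim_inl, app]
    rcases V i with a | a <;> rfl
  · rfl

/-- The letter `none` as a variable. -/
def noneToVar : Option β → Option β ⊕ Unit := fun o => o.elim (Sum.inr ()) fun b => Sum.inl (some b)

lemma app_noneToVar_none (x : ι → Option β) : app (noneToVar ∘ x) (fun _ => none) = x := by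
  funext i
  simp only [app, Function.comp_apply]
  rcases x i with _ | a <;> rfl

lemma app_noneToVar_some (x : ι → Option β) (b : β) :
    app (noneToVar ∘ x) (fun _ => some b) = some ∘ fill b ∘ x := by
  funext i
  simp only [app, Function.comp_apply]
  rcases x i with _ | a <;> rfl

lemma proper_noneToVar {x : ι → Option β} (h : ∃ i, x i = none) : Proper (noneToVar ∘ x) := by
  obtain ⟨i, hi⟩ := h
  exact fun _ => ⟨i, by simp [noneToVar, hi]⟩

lemma app_sumElim {κ : Type} (x : ι → α) (u : κ → α) :
    app (Sum.elim Sum.inr (Sum.inl ∘ u) : ι ⊕ κ → α ⊕ ι) x = Sum.elim x u := by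
  funext i
  rcases i with i | i <;> rfl

/-- The density threshold of the theorem over `Option β` can always be lowered. -/
lemma DHJ.exists_good_sub [Finite β] [Nonempty β] (h : DHJ β) {δ : ℝ} (hδ : 0 < δ)
    (hgood : ∀ ε, 0 < ε → Good (Option β) (δ + ε)) : ∃ ε, 0 < ε ∧ Good (Option β) (δ - ε) := by
  obtain ⟨m₀, hm₀⟩ := h (δ / 2 / 2) (by positivity)
  have hT : (0 : ℝ) < Nat.card (Fin m₀ → β ⊕ Unit) := by exact_mod_cast Nat.card_pos
  set θ : ℝ := δ / 2 / 2 / Nat.card (Fin m₀ → β ⊕ Unit)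
  have hθ : 0 < θ := by positivity
  set γ : ℝ := min (δ * θ / 4) (δ / 2)
  have hγ : 0 < γ := by positivity
  have hγδ : γ ≤ δ / 2 := min_le_right _ _
  obtain ⟨d, hd⟩ := hgood γ hγ
  have hm : ∀ V : Fin m₀ → β ⊕ Unit, ∃ m, Proper V → ∀ (ι : Type) [Finite ι], m ≤ Nat.card ι →
      ∀ g : (ι → Option β) → ℝ, (∀ x, g x ≤ 1) → Neg (id : Option β → Option β) d g →
      ∀ D : β → Set (ι → β), avg (fun c : ι → Fin m₀ ⊕ β =>
        g (lineWord V ∘ c) * (1 - ind (∀ b, fill b ∘ lineWord V ∘ c ∈ D b))) ≤ γ := fun V => by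
    by_cases hV : Proper V
    · obtain ⟨m, hm⟩ := h.avg_mul_compl_le (lineWord_surjective hV) d hγ
      exact ⟨m, fun _ => hm⟩
    · exact ⟨0, fun hV' => absurd hV' hV⟩
  choose mV hmV using hm
  obtain ⟨m, hmm⟩ := Finite.exists_le mV
  set K : ℝ := ((Nat.card (Fin m ⊕ (Fin m₀ ⊕ β) → Option β) : ℕ) : ℝ)
  have hK : 0 < K := Nat.cast_pos.2 Nat.card_pos
  set ε : ℝ := γ / (2 * K)
  have hε : 0 < ε := by positivity
  obtain ⟨n, hn⟩ := hgood ε hε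
  refine ⟨ε, hε, m + Nat.card (Fin m₀ ⊕ β) + n, fun ι _ hι A hA => ?_⟩
  by_contra hline
  obtain ⟨r, e, hr⟩ : ∃ (r : ℕ) (_ : ι ≃ (Fin m ⊕ (Fin m₀ ⊕ β)) ⊕ Fin r), n ≤ r := by
    obtain ⟨r, e, hr⟩ := exists_split hι
    refine ⟨r, e.trans (Equiv.sumCongr ?_ (Equiv.refl _)), hr⟩
    exact finSumFinEquiv.symm.trans (Equiv.sumCongr (Equiv.refl _) (Finite.equivFin _).symm)
  have hsec : ∀ x, δ - γ ≤ avg fun y : Fin r → Option β => ind (glue e x y ∈ A) := fun x => by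
    rw [avg_glue e] at hA
    refine le_trans (le_of_eq ?_) (le_of_avg_of_forall_le (fun x => ?_) hA hε.le x)
    · change δ - γ = δ - 2 * K * ε
      simp only [ε]
      field_simp
    · have hneg := neg_of_not_hasLine hn hline (Fin r) (by simpa using hr)
        (glue e (Sum.inl ∘ x) Sum.inr) (Proper.glue_right e _ proper_inr)
      rw [avg_sub, avg_const] at hneg
      simp only [app_glue, app_inl_comp, app_inr, Function.id_comp] at hneg
      linarith
  obtain ⟨V, hV⟩ := exists_popular_tag (X := (Fin m → Fin m₀ ⊕ β) × (Fin r → Option β))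
    (T := Fin m₀ → β ⊕ Unit)
    (f := fun p => avg fun v : Fin m₀ → β => ind (glue e (some ∘ Sum.elim
      (Sum.elim v id ∘ p.1) (Sum.elim v id)) p.2 ∈ A))
    (fun p => avg_le zero_le_one fun _ => ind_le_one _) (κ := δ / 2) (half_pos hδ)
    (by
      rw [avg_comm]
      refine le_avg fun v => ?_
      rw [avg_prod]
      exact (show δ / 2 ≤ δ - γ by linarith).trans (le_avg fun c =>
        hsec (some ∘ Sum.elim (Sum.elim v id ∘ c) (Sum.elim v id))))
    (R := fun p V => Proper V ∧ ∀ b, glue e (some ∘ Sum.elim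
      (fill b ∘ lineWord V ∘ p.1) (fill b ∘ lineWord V)) p.2 ∈ A)
    (fun p hp => by
      obtain ⟨V, hV, hVA⟩ := hm₀ (Fin m₀) (by simp) {v | glue e (some ∘ Sum.elim
        (Sum.elim v id ∘ p.1) (Sum.elim v id)) p.2 ∈ A} hp
      refine ⟨V, hV, fun b => ?_⟩
      simp only [← Function.comp_assoc, fill_comp_lineWord]
      exact hVA b)
  have hVp : Proper V := by
    by_contra hVp
    have := avg_nonpos fun p : (Fin m → Fin m₀ ⊕ β) × (Fin r → Option β) =>
      (ind_not (p := Proper V ∧ ∀ b, glue e (some ∘ Sum.elim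
      (fill b ∘ lineWord V ∘ p.1) (fill b ∘ lineWord V)) p.2 ∈ A) fun hc => hVp hc.1).le
    linarith
  simp only [hVp, true_and] at hV
  set D : (Fin r → Option β) → β → Set (Fin m → β) := fun y b =>
    {x | glue e (some ∘ Sum.elim x (fill b ∘ lineWord V)) y ∈ A}
  set G : (Fin r → Option β) → Set (Fin m → Option β) := fun y =>
    {x | glue e (Sum.elim x (lineWord V)) y ∈ A}
  have hdisj : ∀ y x, (∀ b, fill b ∘ x ∈ D y b) → x ∉ G y := by
    intro y x hx hxG
    have hnone : ∃ i, (Sum.elim x (lineWord V) : Fin m ⊕ (Fin m₀ ⊕ β) → Option β) i = none := by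
      obtain ⟨i, hi⟩ := lineWord_surjective hVp none
      exact ⟨Sum.inr i, hi⟩
    refine hline ⟨glue e (noneToVar ∘ Sum.elim x (lineWord V)) (Sum.inl ∘ y),
      Proper.glue_left e (proper_noneToVar hnone) _, ?_⟩
    rintro (_ | b)
    · rw [app_glue, app_noneToVar_none, app_inl_comp]
      exact hxG
    · rw [app_glue, app_noneToVar_some, app_inl_comp, Sum.comp_elim]
      exact hx b
  have hfib : ∀ y, (avg fun c : Fin m → Fin m₀ ⊕ β => ind (lineWord V ∘ c ∈ G y)) -
      (δ + γ) * (1 - avg fun c : Fin m → Fin m₀ ⊕ β =>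
        ind (∀ b, fill b ∘ lineWord V ∘ c ∈ D y b)) ≤ γ := fun y => by
    have hW : Proper (glue e (Sum.elim Sum.inr (Sum.inl ∘ lineWord V)) (Sum.inl ∘ y) :
        ι → Option β ⊕ Fin m) :=
      Proper.glue_left e (fun v => ⟨Sum.inl v, rfl⟩) _
    have hneg := (neg_of_not_hasLine hd hline).app hW
    have := hmV V hVp (Fin m) (by simpa using hmm V) (fun x => ind (x ∈ G y) - (δ + γ))
      (fun x => by linarith [ind_le_one (x ∈ G y)])
      (by
        convert hneg using 2 with x
        rw [app_glue, app_inl_comp, app_sumElim]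
        rfl) (D y)
    refine le_trans (le_of_eq ?_) this
    have hone : (1 : ℝ) = avg fun _ : Fin m → Fin m₀ ⊕ β => (1 : ℝ) := (avg_const _).symm
    nth_rewrite 1 [hone]
    rw [← avg_sub, ← avg_const_mul, ← avg_sub]
    congr 1
    funext c
    by_cases hc : ∀ b, fill b ∘ lineWord V ∘ c ∈ D y b
    · rw [ind_of hc, ind_not (hdisj y _ hc)]
      ring
    · rw [ind_not hc]
      ring
  have hsum := avg_mono hfib
  rw [avg_const, avg_sub, avg_const_mul, avg_sub, avg_const] at hsum
  have h1 : δ - γ ≤ avg fun y => avg fun c : Fin m → Fin m₀ ⊕ β => ind (lineWord V ∘ c ∈ G y) := by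
    rw [avg_comm]
    exact le_avg fun c => hsec _
  have h2 : θ ≤ avg fun y => avg fun c : Fin m → Fin m₀ ⊕ β =>
      ind (∀ b, fill b ∘ lineWord V ∘ c ∈ D y b) := by
    rw [avg_comm, ← avg_prod fun p : (Fin m → Fin m₀ ⊕ β) × (Fin r → Option β) =>
      ind (∀ b, fill b ∘ lineWord V ∘ p.1 ∈ D p.2 b)]
    simpa only [D, Set.mem_ofPred_eq, Sum.comp_elim] using hV
  have h3 := mul_le_mul_of_nonneg_left h2 (by positivity : 0 ≤ δ + γ)
  have h4 : γ ≤ δ * θ / 4 := min_le_left _ _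
  nlinarith [mul_pos hγ hθ, mul_pos hδ hθ]

lemma DHJ.congr (e : α ≃ β) (h : DHJ α) : DHJ β := fun δ hδ => by
  obtain ⟨n, hn⟩ := h δ hδ
  refine ⟨n, fun ι _ hι A hA => ?_⟩
  obtain ⟨V, hV, hl⟩ := hn ι hι {x | e ∘ x ∈ A}
    (hA.trans_eq (avg_comp_equiv (Equiv.piCongrRight fun _ => e) fun x => ind (x ∈ A)).symm)
  refine ⟨mapLetters e V, hV.mapLetters e, fun t => ?_⟩
  have := hl (e.symm t)
  rw [Set.mem_ofPred_eq, ← app_mapLetters] at this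
  simpa [Function.comp_def] using this

lemma DHJ.of_subsingleton [Subsingleton α] : DHJ α := fun δ hδ => by
  refine ⟨1, fun ι _ hι A hA => ?_⟩
  have : Nonempty ι := (Nat.card_pos_iff.1 hι).1
  obtain ⟨x, hx⟩ : ∃ x, x ∈ A := by
    by_contra! hA'
    linarith [avg_nonpos fun x : ι → α => (ind_not (hA' x)).le]
  exact ⟨fun _ => Sum.inr (), fun _ => ⟨Classical.arbitrary ι, rfl⟩,
    fun t => by rwa [Subsingleton.elim (app _ _) x]⟩

lemma DHJ.option [Finite β] [Nonempty β] (h : DHJ β) : DHJ (Option β) := by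
  by_contra hcon
  obtain ⟨δ₁, hδ₁, hbad⟩ : ∃ δ, 0 < δ ∧ ¬Good (Option β) δ := by
    simpa only [DHJ, not_forall, exists_prop] using hcon
  set S : Set ℝ := {δ | 0 < δ ∧ Good (Option β) δ}
  have hS : S.Nonempty := ⟨2, two_pos, 0, fun ι _ _ A hA => by
    linarith [avg_le zero_le_one fun x : ι → Option β => ind_le_one (x ∈ A)]⟩
  have hbdd : BddBelow S := ⟨0, fun δ hδ => hδ.1.le⟩
  have hinf : δ₁ ≤ sInf S :=
    le_csInf hS fun δ hδ => le_of_not_ge fun hle => hbad (hδ.2.mono hle)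
  obtain ⟨ε, hε, hgood⟩ := h.exists_good_sub (hδ₁.trans_le hinf) fun ε hε => by
    obtain ⟨δ, hδ, hlt⟩ := exists_lt_of_csInf_lt hS (lt_add_of_pos_right (sInf S) hε)
    exact hδ.2.mono hlt.le
  have hmem : max (sInf S - ε) (sInf S / 2) ∈ S :=
    ⟨lt_max_of_lt_right (by linarith), hgood.mono (le_max_left _ _)⟩
  have := csInf_le hbdd hmem
  rcases le_max_iff.1 this with h | h <;> linarith

/-- The density Hales–Jewett theorem. -/
theorem dhj [Finite α] : DHJ α := by
  induction α using Finite.induction_empty_option with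
  | of_equiv e h => exact h.congr e
  | h_empty => exact .of_subsingleton
  | @h_option β _ h =>
    rcases isEmpty_or_nonempty β with hβ | hβ
    · exact .of_subsingleton
    · exact h.option

lemma avg_comp_addMonoidHom {G H : Type*} [AddGroup G] [AddGroup H] [Finite G] [Finite H]
    (φ : G →+ H) (hφ : Function.Surjective φ) (F : H → ℝ) : (avg fun x => F (φ x)) = avg F := by
  have h : ∀ y, (avg fun x => F (φ x + y)) = avg fun x => F (φ x) := fun y => by
    obtain ⟨z, rfl⟩ := hφ y
    simp only [← map_add]
    exact avg_comp_equiv (Equiv.addRight z) fun x => F (φ x)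
  calc (avg fun x => F (φ x)) = avg fun y => avg fun x => F (φ x + y) := by
        simp only [h, avg_const]
    _ = avg fun x => avg fun y => F (φ x + y) := avg_comm _
    _ = avg F := by
        simp only [fun x => avg_comp_equiv (Equiv.addLeft (φ x)) F, avg_const, ← Equiv.coe_addLeft]

/-- Varnavides' form of Szemerédi's theorem in finite abelian groups. -/
theorem exists_le_avg_prod_progression {k : ℕ} (hk : 0 < k) {δ B : ℝ} (hδ : 0 < δ) (hB : 0 < B) :
    ∃ c : ℝ, 0 < c ∧ ∀ (G : Type) [AddCommGroup G] [Finite G] (f : G → ℝ),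
      (∀ x, 0 ≤ f x ∧ f x ≤ B) → δ ≤ avg f →
        c ≤ avg fun p : G × G => ∏ i ∈ range k, f (p.1 + i • p.2) := by
  have : Nonempty (Fin k) := ⟨⟨0, hk⟩⟩
  obtain ⟨n, hn⟩ := dhj (α := Fin k) (δ / (2 * B) / 2) (by positivity)
  have hT : (0 : ℝ) < Nat.card (Fin n → Fin k ⊕ Unit) := Nat.cast_pos.2 Nat.card_pos
  refine ⟨δ / (2 * B) / 2 / Nat.card (Fin n → Fin k ⊕ Unit) * (δ / 2) ^ k, by positivity,
    fun G _ _ f hf hδf => ?_⟩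
  have hpop : δ / (2 * B) ≤ avg fun x => ind (δ / 2 ≤ f x) := by
    have h : avg f ≤ avg fun x => δ / 2 + B * ind (δ / 2 ≤ f x) := avg_mono fun x => by
      by_cases hx : δ / 2 ≤ f x
      · rw [ind_of hx]
        linarith [hf x]
      · rw [ind_not hx]
        linarith
    rw [avg_add, avg_const, avg_const_mul] at h
    rw [div_le_iff₀ (by positivity)]
    linarith
  obtain ⟨V, hV⟩ := exists_popular_tag (X := G × (Fin n → G)) (T := Fin n → Fin k ⊕ Unit)
    (f := fun p => avg fun w : Fin n → Fin k => ind (δ / 2 ≤ f (p.1 + ∑ i, (w i : ℕ) • p.2 i)))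
    (fun p => avg_le zero_le_one fun _ => ind_le_one _) (κ := δ / (2 * B)) (by positivity)
    (by
      rw [avg_comm]
      refine le_avg fun w => ?_
      rw [avg_prod, avg_comm]
      exact le_avg fun r => hpop.trans_eq
        (avg_comp_equiv (Equiv.addRight (∑ i, (w i : ℕ) • r i)) fun x => ind (δ / 2 ≤ f x)).symm)
    (R := fun p V => Proper V ∧ ∀ t : Fin k,
      δ / 2 ≤ f (p.1 + ∑ i, ((app V (fun _ => t) i : Fin k) : ℕ) • p.2 i))
    (fun p hp => hn (Fin n) (by simp) {w | δ / 2 ≤ f (p.1 + ∑ i, (w i : ℕ) • p.2 i)} hp)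
  have hVp : Proper V := by
    by_contra hVp
    have := avg_nonpos fun p : G × (Fin n → G) => (ind_not (p := Proper V ∧ ∀ t : Fin k,
      δ / 2 ≤ f (p.1 + ∑ i, ((app V (fun _ => t) i : Fin k) : ℕ) • p.2 i)) fun hc => hVp hc.1).le
    have : 0 < δ / (2 * B) / 2 / Nat.card (Fin n → Fin k ⊕ Unit) := by positivity
    linarith
  simp only [hVp, true_and] at hV
  set a : Fin n → ℕ := fun i => (V i).elim (fun l : Fin k => (l : ℕ)) fun _ => 0 with ha
  set b : Fin n → ℕ := fun i => (V i).elim (fun _ => 0) fun _ => 1 with hb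
  have hab : ∀ (t : Fin k) (i : Fin n), ((app V (fun _ => t) i : Fin k) : ℕ) = a i + t * b i :=
      fun t i => by
    simp only [app, ha, hb]
    rcases V i with l | l <;> simp
  let φ : G × (Fin n → G) →+ G × G := AddMonoidHom.mk'
    (fun p => (p.1 + ∑ i, a i • p.2 i, ∑ i, b i • p.2 i)) fun p q => by
      simp only [Prod.fst_add, Prod.snd_add, Pi.add_apply, smul_add, Finset.sum_add_distrib,
        Prod.mk_add_mk, Prod.mk.injEq, and_true]
      abel
  have hφ : Function.Surjective φ := fun ⟨x, r⟩ => by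
    obtain ⟨j, hj⟩ := hVp ()
    have hsum : ∀ u : Fin n → ℕ, ∑ i, u i • (Pi.single j r : Fin n → G) i = u j • r := fun u => by
      rw [Finset.sum_eq_single j] <;> simp +contextual
    refine ⟨(x - a j • r, Pi.single j r), ?_⟩
    simp [φ, hsum, hb, hj]
  calc _ ≤ (avg fun p : G × G => ind (∀ t : Fin k, δ / 2 ≤ f (p.1 + (t : ℕ) • p.2))) *
        (δ / 2) ^ k := by
        gcongr
        rw [← avg_comp_addMonoidHom φ hφ]
        refine hV.trans_eq (congrArg avg (funext fun p => ?_))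
        simp only [φ, hab, add_smul, mul_smul, Finset.sum_add_distrib, Finset.smul_sum, add_assoc,
          AddMonoidHom.mk'_apply]
    _ ≤ _ := by
        rw [mul_comm, ← avg_const_mul]
        refine avg_mono fun p => ?_
        by_cases hp : ∀ t : Fin k, δ / 2 ≤ f (p.1 + (t : ℕ) • p.2)
        · rw [ind_of hp, mul_one, Finset.prod_range]
          refine le_trans (le_of_eq ?_)
            (Finset.prod_le_prod (fun _ _ => (half_pos hδ).le) fun t _ => hp t)
          rw [Finset.prod_const, Finset.card_univ, Fintype.card_fin]
        · rw [ind_not hp, mul_zero]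
          exact Finset.prod_nonneg fun i _ => (hf _).1

end DensityHJ

lemma avg_zmod (m : ℕ) [NeZero m] (g : ZMod m → ℝ) : avgZ m g = DensityHJ.avg g := by
  rw [avgZ, DensityHJ.avg_eq, ZMod.card]
  congr 1
  refine Finset.sum_nbij' (fun i => (i : ZMod m)) ZMod.val (by simp)
    (fun x _ => Finset.mem_range.2 x.val_lt) (fun i hi => ?_) (fun x _ => ZMod.natCast_zmod_val x)
    fun _ _ => rfl
  exact ZMod.val_cast_of_lt (Finset.mem_range.1 hi)

lemma apAvg_eq_avg (k m : ℕ) [NeZero m] (g : ZMod m → ℝ) :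
    apAvg k m g = DensityHJ.avg fun p : ZMod m × ZMod m => ∏ i ∈ range k, g (p.1 + i • p.2) := by
  simp only [DensityHJ.avg_prod, ← avg_zmod, apAvg, avgZ, ← Finset.sum_div, nsmul_eq_mul, sq,
    div_div]

/-- Szemerédi's theorem, Varnavides form: if `0 ≤ f ≤ B` and `E(f) ≥ δ`,
then `liminf E(f(x) f(x+r) ⋯ f(x+(k-1)r) | x, r ∈ Z_M) ≥ c(k,δ) > 0`. -/
theorem szemeredi_varnavides (k : ℕ) (hk : 3 ≤ k) (δ : ℝ) (hδ0 : 0 < δ) (hδ1 : δ ≤ 1)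
    (B : ℝ) (hB : 0 < B) :
    ∃ c : ℝ, 0 < c ∧
      ∀ M : ℕ → ℕ, (∀ N, Nat.Prime (M N)) → Tendsto M atTop atTop →
        ∀ f : (N : ℕ) → ZMod (M N) → ℝ,
          (∀ N (x : ZMod (M N)), 0 ≤ f N x ∧ f N x ≤ B) →
          (∀ N, δ ≤ avgZ (M N) (f N)) →
          ∀ γ : ℝ, 0 < γ → ∃ N₀ : ℕ, ∀ N ≥ N₀, c - γ ≤ apAvg k (M N) (f N) := by
  obtain ⟨c, hc, h⟩ :=
    DensityHJ.exists_le_avg_prod_progression (by omega : 0 < k) hδ0 hB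
  refine ⟨c, hc, fun M hM _ f hf hδ γ hγ => ⟨0, fun N _ => ?_⟩⟩
  have : NeZero (M N) := ⟨(hM N).ne_zero⟩
  have := h (ZMod (M N)) (f N) (hf N) (by rw [← avg_zmod]; exact hδ N)
  rw [apAvg_eq_avg]
  linarith

end
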